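/- arXiv:1709.05124 — 2 statements merged into one kernel-verified Lean document; each statement's English description precedes it below -/
import Mathlib

section
/- Let D ⊂ C^n be a domain and φ : D_unit → D holomorphic (D_unit the unit disc). Suppose there exists a holomorphic map h : D_unit → C^n such that, with ψ_z(λ) := (h(λ)•(z−φ(λ)) − h(0)•(z−φ(0)))/λ + λ·conj(h(0)•(z−φ(0))), one has Re ψ_{φ(0)}(0) ≠ 0 and Re ψ_z(λ) ≤ 0 for all λ in the unit disc and all z ∈ D. Then φ admits a holomorphic left inverse f : D → D_unit with f ∘ φ = id, i.e., φ is a complex geodesic for D. -/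
open Complex Metric

noncomputable section

/-- The bilinear dot product on `ℂⁿ`. -/
def dotn {n : ℕ} (z w : Fin n → ℂ) : ℂ := ∑ j, z j * w j

/-- The function `ψ_z(λ) = (h(λ)•(z-φ(λ)) - h(0)•(z-φ(0)))/λ + λ conj(h(0)•(z-φ(0)))`,
with the removable singularity at `λ = 0` handled by `dslope`. -/
def psi {n : ℕ} (φ h : ℂ → Fin n → ℂ) (z : Fin n → ℂ) (l : ℂ) : ℂ :=
  dslope (fun w => dotn (h w) (z - φ w)) 0 l
    + l * (starRingEnd ℂ) (dotn (h 0) (z - φ 0))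

open Filter Topology ComplexConjugate

/-- **Schwarz–Pick** for maps from the unit disc to the right half-plane. -/
lemma norm_sub_mul_le_of_re_pos {P : ℂ → ℂ} (hP : DifferentiableOn ℂ P (ball 0 1))
    (hre : ∀ l ∈ ball (0 : ℂ) 1, 0 < (P l).re) {a b : ℂ}
    (ha : a ∈ ball (0 : ℂ) 1) (hb : b ∈ ball (0 : ℂ) 1) :
    ‖P b - P a‖ * ‖1 - conj a * b‖ ≤ ‖b - a‖ * ‖P b + conj (P a)‖ := by
  have hden : ∀ x ∈ ball (0 : ℂ) 1, ∀ y ∈ ball (0 : ℂ) 1, 1 - conj x * y ≠ 0 := by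
    intro x hx y hy h
    rw [mem_ball_zero_iff] at hx hy
    have h1 : ‖conj x * y‖ = 1 := by rw [← sub_eq_zero.1 h, norm_one]
    rw [norm_mul, Complex.norm_conj] at h1
    nlinarith [norm_nonneg x, norm_nonneg y]
  have hnorm : ∀ x ∈ ball (0 : ℂ) 1, ∀ y ∈ ball (0 : ℂ) 1,
      ‖y - x‖ < ‖1 - conj x * y‖ := by
    intro x hx y hy
    rw [mem_ball_zero_iff, ← sq_lt_one_iff₀ (norm_nonneg _), ← Complex.normSq_eq_norm_sq] at hx hy
    rw [← sq_lt_sq₀ (norm_nonneg _) (norm_nonneg _), ← Complex.normSq_eq_norm_sq,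
      ← Complex.normSq_eq_norm_sq]
    simp only [Complex.normSq_apply, sub_re, sub_im, mul_re, mul_im, conj_re, conj_im, one_re,
      one_im] at *
    nlinarith [mul_pos (sub_pos.2 hx) (sub_pos.2 hy)]
  have ha' : -a ∈ ball (0 : ℂ) 1 := by simpa using ha
  have hadd : ∀ l ∈ ball (0 : ℂ) 1, P l + conj (P a) ≠ 0 := by
    intro l hl h
    have := congrArg re h
    simp only [add_re, conj_re, zero_re] at this
    linarith [hre l hl, hre a ha]
  let m : ℂ → ℂ := fun w => (w + a) / (1 + conj a * w)
  have hm : Set.MapsTo m (ball 0 1) (ball 0 1) := by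
    intro w hw
    have h1 := hnorm _ ha' w hw
    have h2 := hden _ ha' w hw
    simp only [map_neg, neg_mul, sub_neg_eq_add] at h1 h2
    rw [mem_ball_zero_iff, norm_div, div_lt_one (norm_pos_iff.2 h2)]
    exact h1
  have hmd : DifferentiableOn ℂ m (ball 0 1) := by
    refine DifferentiableOn.div (by fun_prop) (by fun_prop) fun w hw => ?_
    simpa using hden _ ha' w hw
  let K : ℂ → ℂ := fun w => (P (m w) - P a) / (P (m w) + conj (P a))
  have hPm : DifferentiableOn ℂ (fun w => P (m w)) (ball 0 1) := hP.comp hmd hm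
  have hKd : DifferentiableOn ℂ K (ball 0 1) :=
    (hPm.sub_const _).div (hPm.add_const _) fun w hw => hadd _ (hm hw)
  have hm0 : m 0 = a := by simp [m]
  have hK0 : K 0 = 0 := by simp [K, hm0]
  have hKmaps : Set.MapsTo K (ball 0 1) (closedBall 0 1) := by
    intro w hw
    have h1 := hre _ (hm hw)
    have h2 := hre _ ha
    rw [mem_closedBall_zero_iff, norm_div, div_le_one (norm_pos_iff.2 (hadd _ (hm hw))),
      ← sq_le_sq₀ (norm_nonneg _) (norm_nonneg _), ← Complex.normSq_eq_norm_sq,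
      ← Complex.normSq_eq_norm_sq]
    simp only [Complex.normSq_apply, sub_re, sub_im, add_re, add_im, conj_re, conj_im]
    nlinarith [mul_pos h1 h2]
  let w : ℂ := (b - a) / (1 - conj a * b)
  have hab := hden a ha b hb
  have haa := hden a ha a ha
  have hw : w ∈ ball (0 : ℂ) 1 := by
    rw [mem_ball_zero_iff, norm_div, div_lt_one (norm_pos_iff.2 hab)]
    exact hnorm a ha b hb
  have hmw : m w = b := by
    have h1 : 1 + conj a * w = (1 - conj a * a) / (1 - conj a * b) := by
      simp only [w]; field_simp; ring
    have h2 : w + a = b * (1 - conj a * a) / (1 - conj a * b) := by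
      simp only [w]
      rw [eq_div_iff hab, add_mul, div_mul_cancel₀ _ hab]
      ring
    simp only [m]
    rw [h1, h2, div_div_div_cancel_right₀ hab, mul_div_assoc, div_self haa, mul_one]
  have key := Complex.dist_le_div_mul_dist_of_mapsTo_ball hKd (by rwa [hK0]) hw
  simp only [hK0, dist_zero_right, div_one, one_mul] at key
  simp only [K, hmw, norm_div] at key
  simp only [w, norm_div] at key
  rwa [div_le_div_iff₀ (norm_pos_iff.2 (hadd b hb)) (norm_pos_iff.2 hab)] at key

lemma norm_deriv_mul_le_of_re_pos {P : ℂ → ℂ} (hP : DifferentiableOn ℂ P (ball 0 1))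
    (hre : ∀ l ∈ ball (0 : ℂ) 1, 0 < (P l).re) {a : ℂ} (ha : a ∈ ball (0 : ℂ) 1) :
    ‖deriv P a‖ * ‖1 - conj a * a‖ ≤ ‖P a + conj (P a)‖ := by
  have hPa : DifferentiableAt ℂ P a := hP.differentiableAt (isOpen_ball.mem_nhds ha)
  have h1 : Tendsto (fun b => ‖dslope P a b‖ * ‖1 - conj a * b‖) (𝓝[≠] a)
      (𝓝 (‖deriv P a‖ * ‖1 - conj a * a‖)) := by
    have : ContinuousAt (fun b => ‖dslope P a b‖ * ‖1 - conj a * b‖) a := by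
      have := continuousAt_dslope_same.2 hPa
      fun_prop
    simpa using this.tendsto.mono_left nhdsWithin_le_nhds
  have h2 : Tendsto (fun b => ‖P b + conj (P a)‖) (𝓝[≠] a) (𝓝 ‖P a + conj (P a)‖) :=
    ((hPa.continuousAt.add continuousAt_const).norm).tendsto.mono_left nhdsWithin_le_nhds
  refine le_of_tendsto_of_tendsto h1 h2 ?_
  filter_upwards [self_mem_nhdsWithin, nhdsWithin_le_nhds (isOpen_ball.mem_nhds ha)] with b hb hb1
  have hba : 0 < ‖b - a‖ := norm_pos_iff.2 (sub_ne_zero.2 hb)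
  rw [dslope_of_ne _ hb, slope_def_field, norm_div, div_mul_eq_mul_div, div_le_iff₀ hba,
    mul_comm ‖P b + conj (P a)‖]
  exact norm_sub_mul_le_of_re_pos hP hre ha hb1

lemma norm_mul_conj_add_lt {a b c : ℂ} (ha : ‖a‖ < 1) (hb : ‖b‖ < 1) (hc : c ≠ 0) :
    ‖c * conj b + conj c * a‖ < ‖c + conj c * (a * b)‖ := by
  rw [← sq_lt_one_iff₀ (norm_nonneg _), ← Complex.normSq_eq_norm_sq] at ha hb
  have hc' := Complex.normSq_pos.2 hc
  rw [← sq_lt_sq₀ (norm_nonneg _) (norm_nonneg _), ← Complex.normSq_eq_norm_sq,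
    ← Complex.normSq_eq_norm_sq]
  have := mul_pos hc' (mul_pos (sub_pos.2 ha) (sub_pos.2 hb))
  simp only [Complex.normSq_apply, add_re, add_im, mul_re, mul_im, conj_re, conj_im] at *
  nlinarith

/-- Uniqueness of the null point in the disc of a Berkson–Porta type vector field. -/
lemma eq_of_zeros {P : ℂ → ℂ} (hP : DifferentiableOn ℂ P (ball 0 1))
    (hre : ∀ l ∈ ball (0 : ℂ) 1, 0 < (P l).re) {a b c : ℂ}
    (ha : a ∈ ball (0 : ℂ) 1) (hb : b ∈ ball (0 : ℂ) 1)
    (hPa : c - conj c * a ^ 2 - a * P a = 0) (hPb : c - conj c * b ^ 2 - b * P b = 0) :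
    a = b := by
  have hP0 : ∀ l ∈ ball (0 : ℂ) 1, P l ≠ 0 := by
    intro l hl h
    simpa [h] using hre l hl
  rcases eq_or_ne c 0 with rfl | hc
  · have h1 : a = 0 := by simpa [hP0 a ha] using hPa
    have h2 : b = 0 := by simpa [hP0 b hb] using hPb
    rw [h1, h2]
  have ha0 : a ≠ 0 := by rintro rfl; simp [hc] at hPa
  have hb0 : b ≠ 0 := by rintro rfl; simp [hc] at hPb
  by_contra hne
  have hca : conj a ≠ 0 := by simpa using ha0
  have key := norm_sub_mul_le_of_re_pos hP hre ha hb
  have ea : P a = (c - conj c * a ^ 2) / a := by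
    rw [eq_div_iff ha0]; linear_combination -hPa
  have eb : P b = (c - conj c * b ^ 2) / b := by
    rw [eq_div_iff hb0]; linear_combination -hPb
  have e1 : P b - P a = -(b - a) * (c + conj c * (a * b)) / (a * b) := by
    rw [ea, eb]; field_simp; ring
  have e2 : P b + conj (P a) = (1 - conj a * b) * (c * conj a + conj c * b) / (conj a * b) := by
    rw [ea, eb]; simp only [map_div₀, map_sub, map_mul, map_pow, conj_conj]; field_simp; ring
  rw [e1, e2] at key
  simp only [norm_mul, norm_div, norm_neg, Complex.norm_conj] at key
  rw [mem_ball_zero_iff] at ha hb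
  have hlt := norm_mul_conj_add_lt hb ha hc
  rw [mul_comm b a] at hlt
  have hba : 0 < ‖b - a‖ := norm_pos_iff.2 (sub_ne_zero.2 (Ne.symm hne))
  have hd : 0 < ‖1 - conj a * b‖ := by
    refine norm_pos_iff.2 fun h => ?_
    have h1 : ‖conj a * b‖ = 1 := by rw [← sub_eq_zero.1 h, norm_one]
    rw [norm_mul, Complex.norm_conj] at h1
    nlinarith [norm_nonneg a, norm_nonneg b]
  have hA := norm_pos_iff.2 ha0
  have hB := norm_pos_iff.2 hb0
  have hf : 0 < ‖b - a‖ * ‖1 - conj a * b‖ / (‖a‖ * ‖b‖) := by positivity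
  have := mul_lt_mul_of_pos_left hlt hf
  refine absurd key (not_le.2 ?_)
  convert this using 1 <;> ring

lemma deriv_ne_zero_of_zero {P : ℂ → ℂ} (hP : DifferentiableOn ℂ P (ball 0 1))
    (hre : ∀ l ∈ ball (0 : ℂ) 1, 0 < (P l).re) {a c : ℂ} (ha : a ∈ ball (0 : ℂ) 1)
    (hPa : c - conj c * a ^ 2 - a * P a = 0) :
    deriv (fun l => c - conj c * l ^ 2 - l * P l) a ≠ 0 := by
  have hPd : HasDerivAt P (deriv P a) a :=
    (hP.differentiableAt (isOpen_ball.mem_nhds ha)).hasDerivAt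
  have hd : HasDerivAt (fun l => c - conj c * l ^ 2 - l * P l)
      (-(conj c * (2 * a)) - (P a + a * deriv P a)) a := by
    exact (((((hasDerivAt_id a).pow 2).const_mul (conj c)).const_sub c).sub
      ((hasDerivAt_id a).mul hPd)).congr_deriv (by simp)
  rw [hd.deriv]
  intro h
  have hP0 : P a ≠ 0 := by
    intro h
    simpa [h] using hre a ha
  rcases eq_or_ne c 0 with rfl | hc
  · have h1 : a = 0 := by simpa [hP0] using hPa
    subst h1
    simp [hP0] at h
  have ha0 : a ≠ 0 := by rintro rfl; simp [hc] at hPa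
  have hca : conj a ≠ 0 := by simpa using ha0
  have key := norm_deriv_mul_le_of_re_pos hP hre ha
  have ea : P a = (c - conj c * a ^ 2) / a := by
    rw [eq_div_iff ha0]; linear_combination -hPa
  have e1 : deriv P a = -(c + conj c * (a * a)) / (a * a) := by
    rw [eq_div_iff (mul_ne_zero ha0 ha0)]
    linear_combination -a * h + hPa
  have e2 : P a + conj (P a) = (1 - conj a * a) * (c * conj a + conj c * a) / (conj a * a) := by
    rw [ea]; simp only [map_div₀, map_sub, map_mul, map_pow, conj_conj]; field_simp; ring
  rw [e1, e2] at key
  simp only [norm_mul, norm_div, norm_neg, Complex.norm_conj] at key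
  rw [mem_ball_zero_iff] at ha
  have hlt := norm_mul_conj_add_lt ha ha hc
  have hd : 0 < ‖1 - conj a * a‖ := by
    refine norm_pos_iff.2 fun h => ?_
    have h1 : ‖conj a * a‖ = 1 := by rw [← sub_eq_zero.1 h, norm_one]
    rw [norm_mul, Complex.norm_conj] at h1
    nlinarith [norm_nonneg a]
  have hA := norm_pos_iff.2 ha0
  have hf : 0 < ‖1 - conj a * a‖ / (‖a‖ * ‖a‖) := by positivity
  have := mul_lt_mul_of_pos_left hlt hf
  refine absurd key (not_le.2 ?_)
  convert this using 1 <;> ring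

lemma norm_sq_le_of_mapsTo_ball {E : Type*} [NormedAddCommGroup E] [NormedSpace ℂ E]
    {F : E → ℂ} {x y : E} {R ρ : ℝ} (hF : DifferentiableOn ℂ F (ball x R))
    (hmaps : Set.MapsTo F (ball x R) (ball 0 1)) (hR : 0 < R) (hxy : dist y x ≤ R / 2)
    (hρ : ‖F x‖ ≤ ρ) (hρ1 : ρ < 1) :
    ‖F y‖ ^ 2 ≤ 1 - 3 / 4 * (1 - ρ) ^ 2 := by
  have hy : y ∈ ball x R := by rw [mem_ball]; linarith
  have hden : ∀ u ∈ ball x R, 1 - conj (F x) * F u ≠ 0 := by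
    intro u hu h
    have h2 := hmaps hu
    rw [mem_ball_zero_iff] at h2
    have h1 : ‖conj (F x) * F u‖ = 1 := by rw [← sub_eq_zero.1 h, norm_one]
    rw [norm_mul, Complex.norm_conj] at h1
    nlinarith [norm_nonneg (F u), norm_nonneg (F x)]
  let K : E → ℂ := fun u => (F u - F x) / (1 - conj (F x) * F u)
  have hKd : DifferentiableOn ℂ K (ball x R) := by
    simp only [K, div_eq_mul_inv]
    exact (hF.sub_const _).mul (((hF.const_mul _).const_sub _).inv hden)
  have hKx : K x = 0 := by simp [K]
  have id1 : ∀ p q : ℂ, ‖1 - conj p * q‖ ^ 2 - ‖q - p‖ ^ 2 = (1 - ‖p‖ ^ 2) * (1 - ‖q‖ ^ 2) := by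
    intro p q
    simp only [← Complex.normSq_eq_norm_sq, Complex.normSq_apply, sub_re, sub_im, mul_re, mul_im,
      conj_re, conj_im, one_re, one_im]
    ring
  have hKmaps : Set.MapsTo K (ball x R) (closedBall 0 1) := by
    intro u hu
    have h2 := hmaps hu
    have h1 := hmaps (mem_ball_self hR)
    rw [mem_ball_zero_iff, ← sq_lt_one_iff₀ (norm_nonneg _)] at h1 h2
    rw [mem_closedBall_zero_iff, norm_div, div_le_one (norm_pos_iff.2 (hden u hu)),
      ← sq_le_sq₀ (norm_nonneg _) (norm_nonneg _)]
    nlinarith [id1 (F x) (F u), mul_pos (sub_pos.2 h1) (sub_pos.2 h2)]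
  have key := Complex.dist_le_div_mul_dist_of_mapsTo_ball hKd (by rwa [hKx]) hy
  rw [hKx, dist_zero_right] at key
  have hK : ‖K y‖ ≤ 1 / 2 := by
    refine key.trans ?_
    rw [one_div_mul_eq_div, div_le_iff₀ hR]
    linarith
  simp only [K, norm_div] at hK
  rw [div_le_iff₀ (norm_pos_iff.2 (hden y hy))] at hK
  have hsq : ‖F y - F x‖ ^ 2 ≤ 1 / 4 * ‖1 - conj (F x) * F y‖ ^ 2 := by
    have := pow_le_pow_left₀ (norm_nonneg _) hK 2
    linarith
  have hlow : 1 - ρ ≤ ‖1 - conj (F x) * F y‖ := by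
    have h1 := norm_sub_norm_le (1 : ℂ) (conj (F x) * F y)
    rw [norm_one, norm_mul, Complex.norm_conj] at h1
    have h2 := hmaps hy
    rw [mem_ball_zero_iff] at h2
    nlinarith [norm_nonneg (F x), norm_nonneg (F y)]
  have hlow2 := pow_le_pow_left₀ (sub_pos.2 hρ1).le hlow 2
  have h2 := hmaps hy
  rw [mem_ball_zero_iff, ← sq_lt_one_iff₀ (norm_nonneg _)] at h2
  nlinarith [id1 (F x) (F y), sq_nonneg ‖F x‖, mul_nonneg (sq_nonneg ‖F x‖) (sub_pos.2 h2).le]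

/-- Implicit function theorem for a scalar equation with simple root. -/
lemma exists_differentiableAt_zero {E : Type*} [NormedAddCommGroup E] [NormedSpace ℂ E]
    [CompleteSpace E] {G : E × ℂ → ℂ} {z : E} {a : ℂ} (hG : ContDiffAt ℂ 1 G (z, a))
    (h0 : G (z, a) = 0) (hd : deriv (fun l => G (z, l)) a ≠ 0) :
    ∃ u : E → ℂ, DifferentiableAt ℂ u z ∧ u z = a ∧ ∀ᶠ x in 𝓝 z, G (x, u x) = 0 := by
  have hs := hG.hasStrictFDerivAt one_ne_zero
  have hcomp : HasFDerivAt (fun l => G (z, l)) (fderiv ℂ G (z, a) ∘L .inr ℂ E ℂ) a :=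
    hs.hasFDerivAt.comp a (hasFDerivAt_prodMk_right z a)
  have hinv : (fderiv ℂ G (z, a) ∘L .inr ℂ E ℂ).IsInvertible := by
    refine ⟨ContinuousLinearEquiv.unitsEquivAut ℂ (Units.mk0 _ hd), ?_⟩
    ext
    rw [← hcomp.hasDerivAt.deriv]
    simp
  refine ⟨hs.implicitFunctionOfProdDomain hinv,
    (hs.hasStrictFDerivAt_implicitFunctionOfProdDomain hinv).hasFDerivAt.differentiableAt,
    (hs.eventually_apply_eq_iff_implicitFunctionOfProdDomain hinv).self_of_nhds.mp rfl, ?_⟩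
  have := hs.eventually_apply_implicitFunctionOfProdDomain hinv
  rwa [h0] at this

/-- A family `G (z, ·)` of Berkson–Porta type vector fields on the disc with null point at `0`,
depending holomorphically on `z ∈ D`. -/
structure IsGeneratorFamily {E : Type*} [NormedAddCommGroup E] [NormedSpace ℂ E] (D : Set E)
    (G : E × ℂ → ℂ) (P : E → ℂ → ℂ) : Prop where
  contDiffAt : ∀ z ∈ D, ∀ l ∈ ball (0 : ℂ) 1, ContDiffAt ℂ 1 G (z, l)
  eq : ∀ z ∈ D, ∀ l ∈ ball (0 : ℂ) 1, G (z, l) = G (z, 0) - conj (G (z, 0)) * l ^ 2 - l * P z l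
  differentiableOn : ∀ z ∈ D, DifferentiableOn ℂ (P z) (ball 0 1)
  re_pos : ∀ z ∈ D, ∀ l ∈ ball (0 : ℂ) 1, 0 < (P z l).re

namespace IsGeneratorFamily

variable {E : Type*} [NormedAddCommGroup E] [NormedSpace ℂ E] {D : Set E}
    {G : E × ℂ → ℂ} {P : E → ℂ → ℂ}

lemma zero_unique (H : IsGeneratorFamily D G P) {z : E} (hz : z ∈ D) {a b : ℂ}
    (ha : a ∈ ball (0 : ℂ) 1) (hb : b ∈ ball (0 : ℂ) 1) (hGa : G (z, a) = 0)
    (hGb : G (z, b) = 0) : a = b :=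
  eq_of_zeros (H.differentiableOn z hz) (H.re_pos z hz) ha hb
    ((H.eq z hz a ha).symm.trans hGa) ((H.eq z hz b hb).symm.trans hGb)

lemma deriv_ne_zero (H : IsGeneratorFamily D G P) {z : E} (hz : z ∈ D) {a : ℂ}
    (ha : a ∈ ball (0 : ℂ) 1) (hGa : G (z, a) = 0) : deriv (fun l => G (z, l)) a ≠ 0 := by
  have : (fun l => G (z, l)) =ᶠ[𝓝 a]
      fun l => G (z, 0) - conj (G (z, 0)) * l ^ 2 - l * P z l := by
    filter_upwards [isOpen_ball.mem_nhds ha] with l hl using H.eq z hz l hl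
  rw [this.deriv_eq]
  exact deriv_ne_zero_of_zero (H.differentiableOn z hz) (H.re_pos z hz) ha
    ((H.eq z hz a ha).symm.trans hGa)

lemma exists_local_zero [CompleteSpace E] (H : IsGeneratorFamily D G P) {z : E} (hz : z ∈ D)
    {a : ℂ} (ha : a ∈ ball (0 : ℂ) 1) (hGa : G (z, a) = 0) :
    ∃ u : E → ℂ, DifferentiableAt ℂ u z ∧
      ∀ᶠ x in 𝓝 z, u x ∈ ball (0 : ℂ) 1 ∧ G (x, u x) = 0 := by
  obtain ⟨u, hu, hua, hev⟩ := exists_differentiableAt_zero (H.contDiffAt z hz a ha) hGa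
    (H.deriv_ne_zero hz ha hGa)
  exact ⟨u, hu, (hu.continuousAt.eventually_mem
    (isOpen_ball.mem_nhds (by rwa [hua]))).and hev⟩

lemma differentiableOn_zero [CompleteSpace E] (H : IsGeneratorFamily D G P) (hD : IsOpen D)
    {f : E → ℂ} (hf : ∀ z ∈ D, f z ∈ ball (0 : ℂ) 1 ∧ G (z, f z) = 0) :
    DifferentiableOn ℂ f D := by
  intro z hz
  obtain ⟨u, hu, hev⟩ := H.exists_local_zero hz (hf z hz).1 (hf z hz).2
  refine (hu.congr_of_eventuallyEq ?_).differentiableWithinAt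
  filter_upwards [hev, hD.mem_nhds hz] with x hx hxD
  exact H.zero_unique hxD (hf x hxD).1 hx.1 (hf x hxD).2 hx.2

lemma continuousOn_zero_right (H : IsGeneratorFamily D G P) :
    ContinuousOn (fun z => G (z, 0)) D := by
  intro z hz
  have h1 := (H.contDiffAt z hz 0 (mem_ball_self one_pos)).continuousAt
  have h2 : ContinuousAt (fun z : E => (z, (0 : ℂ))) z := by fun_prop
  exact (h1.comp (f := fun z : E => (z, (0 : ℂ))) h2).continuousWithinAt

/-- If `Re P` is bounded below by a positive constant, zeros exist in the disc for every `z` as soon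
as they exist for one. -/
lemma exists_zero_of_re_ge [CompleteSpace E] (H : IsGeneratorFamily D G P) (hD : IsOpen D)
    (hDc : IsPreconnected D) {δ : ℝ} (hδ : 0 < δ)
    (hP : ∀ z ∈ D, ∀ l ∈ ball (0 : ℂ) 1, δ ≤ (P z l).re)
    {z₀ : E} (hz₀ : z₀ ∈ D) (h0 : G (z₀, 0) = 0) :
    ∀ z ∈ D, ∃ a ∈ ball (0 : ℂ) 1, G (z, a) = 0 := by
  let U : Set E := {z | z ∈ D ∧ ∃ a ∈ ball (0 : ℂ) 1, G (z, a) = 0}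
  have hU : IsOpen U := by
    rw [isOpen_iff_mem_nhds]
    rintro z ⟨hz, a, ha, hGa⟩
    obtain ⟨u, -, hev⟩ := H.exists_local_zero hz ha hGa
    filter_upwards [hev, hD.mem_nhds hz] with x hx hxD using ⟨hxD, u x, hx⟩
  suffices D ⊆ U from fun z hz => (this hz).2
  refine hDc.subset_of_closure_inter_subset hU ⟨z₀, hz₀, hz₀, 0, mem_ball_self one_pos, h0⟩ ?_
  rintro z ⟨hzU, hz⟩
  obtain ⟨x, hxU, hx⟩ := mem_closure_iff_seq_limit.1 hzU
  choose hxD a ha hGa using hxU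
  obtain ⟨l, hl, s, hs, hsl⟩ := (isCompact_closedBall (0 : ℂ) 1).tendsto_subseq
    fun k => ball_subset_closedBall (ha k)
  have hxs : Tendsto (fun k => x (s k)) atTop (𝓝 z) := hx.comp hs.tendsto_atTop
  have hbound : ∀ k, ‖a (s k)‖ ^ 2 * δ ≤
      ‖G (x (s k), 0)‖ * ‖a (s k)‖ * (1 - ‖a (s k)‖ ^ 2) := by
    intro k
    have h1 := H.eq _ (hxD (s k)) _ (ha (s k))
    rw [hGa] at h1
    have h2 := hP _ (hxD (s k)) _ (ha (s k))
    have h3 := ha (s k)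
    rw [mem_ball_zero_iff, ← sq_lt_one_iff₀ (norm_nonneg _)] at h3
    generalize G (x (s k), 0) = c at *
    generalize a (s k) = b at *
    generalize P (x (s k)) b = p at *
    have h4 : ‖b‖ ^ 2 * p.re = (c * conj b).re * (1 - ‖b‖ ^ 2) := by
      have := congrArg re (congrArg (fun w => conj b * w) h1)
      rw [← Complex.normSq_eq_norm_sq]
      simp only [pow_two, Complex.normSq_apply, sub_re, sub_im, mul_re, mul_im, conj_re, conj_im,
        zero_re, zero_im] at this ⊢
      linarith
    calc ‖b‖ ^ 2 * δ ≤ ‖b‖ ^ 2 * p.re := by gcongr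
      _ = (c * conj b).re * (1 - ‖b‖ ^ 2) := h4
      _ ≤ ‖c * conj b‖ * (1 - ‖b‖ ^ 2) := by
        gcongr
        exact re_le_norm _
      _ = _ := by rw [norm_mul, Complex.norm_conj]
  have hc : Tendsto (fun k => G (x (s k), 0)) atTop (𝓝 (G (z, 0))) :=
    ((H.continuousOn_zero_right z hz).continuousAt (hD.mem_nhds hz)).tendsto.comp hxs
  have hlim := le_of_tendsto_of_tendsto' ((hsl.norm.pow 2).mul_const δ)
    ((hc.norm.mul hsl.norm).mul ((hsl.norm.pow 2).const_sub 1)) hbound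
  have hl1 : l ∈ ball (0 : ℂ) 1 := by
    rw [mem_closedBall_zero_iff] at hl
    rw [mem_ball_zero_iff]
    refine lt_of_le_of_ne hl fun h => ?_
    simp only [h] at hlim
    linarith
  refine ⟨hz, l, hl1, ?_⟩
  have := (H.contDiffAt z hz l hl1).continuousAt.tendsto.comp (hxs.prodMk_nhds hsl)
  exact tendsto_nhds_unique this (by simp [Function.comp_def, hGa])

lemma sub_mul (H : IsGeneratorFamily D G P) {ε : ℝ} (hε : 0 ≤ ε) :
    IsGeneratorFamily D (fun p => G p - ε * p.2) (fun z l => P z l + ε) where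
  contDiffAt z hz l hl := (H.contDiffAt z hz l hl).sub (contDiffAt_const.mul contDiffAt_snd)
  eq z hz l hl := by
    simp only [mul_zero, sub_zero]
    rw [H.eq z hz l hl]
    ring
  differentiableOn z hz := (H.differentiableOn z hz).add_const _
  re_pos z hz l hl := by
    simpa using add_pos_of_pos_of_nonneg (H.re_pos z hz l hl) hε

/-- Zeros exist in the disc for every `z` as soon as `0` is a zero for one `z₀`: perturb, and use
Harnack-type bounds for the zeros of the perturbed family. -/
lemma exists_zero [CompleteSpace E] (H : IsGeneratorFamily D G P) (hD : IsOpen D)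
    (hDc : IsPreconnected D) {z₀ : E} (hz₀ : z₀ ∈ D) (h0 : G (z₀, 0) = 0) :
    ∀ z ∈ D, ∃ a ∈ ball (0 : ℂ) 1, G (z, a) = 0 := by
  let ε : ℕ → ℝ := fun k => 1 / ((k : ℝ) + 1)
  have hε : ∀ k, 0 < ε k := fun k => Nat.one_div_pos_of_nat
  have hex : ∀ k, ∀ z, ∃ a : ℂ, z ∈ D → a ∈ ball (0 : ℂ) 1 ∧ G (z, a) - ε k * a = 0 := by
    intro k z
    by_cases hz : z ∈ D
    · obtain ⟨a, ha, h⟩ := (H.sub_mul (hε k).le).exists_zero_of_re_ge hD hDc (hε k)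
        (fun z hz l hl => by simpa using (H.re_pos z hz l hl).le) hz₀ (by simpa using h0) z hz
      exact ⟨a, fun _ => ⟨ha, h⟩⟩
    · exact ⟨0, fun h => absurd h hz⟩
  choose f hf using hex
  have hfd : ∀ k, DifferentiableOn ℂ (f k) D := fun k =>
    (H.sub_mul (hε k).le).differentiableOn_zero hD (hf k)
  have hmaps : ∀ k, Set.MapsTo (f k) D (ball 0 1) := fun k z hz => (hf k z hz).1
  have hf0 : ∀ k, f k z₀ = 0 := fun k =>
    (H.sub_mul (hε k).le).zero_unique hz₀ (hf k z₀ hz₀).1 (mem_ball_self one_pos)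
      (hf k z₀ hz₀).2 (by simpa using h0)
  have hstep : ∀ x y : E, ∀ R > 0, ball x R ⊆ D → dist y x ≤ R / 2 →
      (∃ ρ < 1, ∀ k, ‖f k x‖ ≤ ρ) → ∃ ρ < 1, ∀ k, ‖f k y‖ ≤ ρ := by
    rintro x y R hR hsub hxy ⟨ρ, hρ1, hρ⟩
    refine ⟨√(1 - 3 / 4 * (1 - ρ) ^ 2), ?_, fun k => Real.le_sqrt_of_sq_le ?_⟩
    · rw [Real.sqrt_lt' one_pos]
      nlinarith [pow_pos (sub_pos.2 hρ1) 2]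
    · exact norm_sq_le_of_mapsTo_ball ((hfd k).mono hsub) ((hmaps k).mono_left hsub) hR hxy
        (hρ k) hρ1
  let U : Set E := {z | z ∈ D ∧ ∃ ρ < 1, ∀ k, ‖f k z‖ ≤ ρ}
  have hU : IsOpen U := by
    rw [Metric.isOpen_iff]
    rintro x ⟨hx, hρ⟩
    obtain ⟨R, hR, hsub⟩ := Metric.isOpen_iff.1 hD x hx
    refine ⟨R / 2, by positivity, fun y hy => ?_⟩
    rw [mem_ball] at hy
    exact ⟨hsub (by rw [mem_ball]; linarith), hstep x y R hR hsub hy.le hρ⟩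
  have hDU : D ⊆ U := by
    refine hDc.subset_of_closure_inter_subset hU
      ⟨z₀, hz₀, hz₀, 0, one_pos, fun k => by simp [hf0]⟩ ?_
    rintro y ⟨hyU, hy⟩
    obtain ⟨R, hR, hsub⟩ := Metric.isOpen_iff.1 hD y hy
    obtain ⟨x, hxU, hyx⟩ := Metric.mem_closure_iff.1 hyU (R / 4) (by positivity)
    refine ⟨hy, hstep x y (R / 2) (by positivity) (fun u hu => hsub ?_) (by linarith) hxU.2⟩
    rw [mem_ball] at hu ⊢
    linarith [dist_triangle u x y, dist_comm x y]
  intro z hz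
  obtain ⟨-, ρ, hρ1, hρ⟩ := hDU hz
  obtain ⟨l, hl, s, hs, hsl⟩ := (isCompact_closedBall (0 : ℂ) ρ).tendsto_subseq
    (x := fun k => f k z) fun k => mem_closedBall_zero_iff.2 (hρ k)
  have hl1 : l ∈ ball (0 : ℂ) 1 := closedBall_subset_ball hρ1 hl
  refine ⟨l, hl1, ?_⟩
  have h1 : Tendsto (fun k => G (z, f (s k) z)) atTop (𝓝 (G (z, l))) :=
    (H.contDiffAt z hz l hl1).continuousAt.tendsto.comp (tendsto_const_nhds.prodMk_nhds hsl)
  have h2 : Tendsto (fun k => (ε (s k) : ℂ) * f (s k) z) atTop (𝓝 (((0 : ℝ) : ℂ) * l)) := by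
    refine Tendsto.mul ?_ hsl
    exact (continuous_ofReal.tendsto 0).comp
      (tendsto_one_div_add_atTop_nhds_zero_nat.comp hs.tendsto_atTop)
  have h3 := h1.sub h2
  simp only [ofReal_zero, zero_mul, sub_zero] at h3
  exact tendsto_nhds_unique h3 (by simp [hf _ z hz |>.2])

end IsGeneratorFamily

lemma re_neg_of_re_nonpos {E : Type*} [NormedAddCommGroup E] [NormedSpace ℂ E] {U : Set E}
    (hU : IsOpen U) (hUc : IsPreconnected U) {F : E → ℂ} (hF : DifferentiableOn ℂ F U)
    (hre : ∀ z ∈ U, (F z).re ≤ 0) {x : E} (hx : x ∈ U) (hFx : (F x).re ≠ 0) :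
    ∀ z ∈ U, (F z).re < 0 := by
  intro z hz
  refine lt_of_le_of_ne (hre z hz) fun h => hFx ?_
  have hmax : IsMaxOn (norm ∘ fun z => Complex.exp (F z)) U z := by
    intro y hy
    simpa [Complex.norm_exp, h] using hre y hy
  have := Complex.norm_eqOn_of_isPreconnected_of_isMaxOn hUc hU hF.cexp hz hmax hx
  simpa [Complex.norm_exp, h] using this

lemma psi_differentiableOn {n : ℕ} {φ h : ℂ → Fin n → ℂ}
    (hφ : DifferentiableOn ℂ φ (ball (0 : ℂ) 1)) (hh : DifferentiableOn ℂ h (ball (0 : ℂ) 1))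
    (z : Fin n → ℂ) : DifferentiableOn ℂ (psi φ h z) (ball 0 1) := by
  have hg : DifferentiableOn ℂ (fun w => dotn (h w) (z - φ w)) (ball 0 1) := by
    unfold dotn
    refine DifferentiableOn.fun_sum fun j _ => ?_
    exact (differentiableOn_pi.1 hh j).mul ((differentiableOn_pi.1 hφ j).const_sub (z j))
  have := (Complex.differentiableOn_dslope (isOpen_ball.mem_nhds (mem_ball_self one_pos))).2 hg
  exact this.add (differentiableOn_id.mul_const _)

lemma psi_zero {n : ℕ} {φ h : ℂ → Fin n → ℂ} (hφ : DifferentiableAt ℂ φ 0)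
    (hh : DifferentiableAt ℂ h 0) (z : Fin n → ℂ) :
    psi φ h z 0 = dotn (deriv h 0) (z - φ 0) - dotn (h 0) (deriv φ 0) := by
  have hd : HasDerivAt (fun w => dotn (h w) (z - φ w))
      (∑ j, (deriv h 0 j * (z j - φ 0 j) + h 0 j * (-deriv φ 0 j))) 0 := by
    refine HasDerivAt.fun_sum fun j _ => ?_
    exact (hasDerivAt_pi.1 hh.hasDerivAt j).mul ((hasDerivAt_pi.1 hφ.hasDerivAt j).const_sub (z j))
  rw [psi, dslope_same, hd.deriv, zero_mul, add_zero]
  simp only [dotn, Pi.sub_apply]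
  rw [← Finset.sum_sub_distrib]
  exact Finset.sum_congr rfl fun j _ => by ring

lemma dotn_eq_psi {n : ℕ} (φ h : ℂ → Fin n → ℂ) (z : Fin n → ℂ) (l : ℂ) :
    dotn (h l) (z - φ l) = dotn (h 0) (z - φ 0) - conj (dotn (h 0) (z - φ 0)) * l ^ 2
      - l * -psi φ h z l := by
  have := sub_smul_dslope (fun w => dotn (h w) (z - φ w)) 0 l
  simp only [sub_zero, smul_eq_mul] at this
  unfold psi
  linear_combination -this

lemma isGeneratorFamily_dotn {n : ℕ} {D : Set (Fin n → ℂ)}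
    (hDopen : IsOpen D) (hDconn : IsPreconnected D)
    {φ h : ℂ → Fin n → ℂ} (hφ : DifferentiableOn ℂ φ (ball (0 : ℂ) 1))
    (hφD : Set.MapsTo φ (ball (0 : ℂ) 1) D) (hh : DifferentiableOn ℂ h (ball (0 : ℂ) 1))
    (h0 : (psi φ h (φ 0) 0).re ≠ 0)
    (hneg : ∀ l ∈ ball (0 : ℂ) 1, ∀ z ∈ D, (psi φ h z l).re ≤ 0) :
    IsGeneratorFamily D (fun p => dotn (h p.2) (p.1 - φ p.2)) (fun z l => -psi φ h z l) where
  contDiffAt z _ l hl := by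
    have hφl : ContDiffAt ℂ 1 φ l :=
      (hφ.contDiffOn isOpen_ball).contDiffAt (isOpen_ball.mem_nhds hl)
    have hhl : ContDiffAt ℂ 1 h l :=
      (hh.contDiffOn isOpen_ball).contDiffAt (isOpen_ball.mem_nhds hl)
    unfold dotn
    refine ContDiffAt.sum fun j _ => ?_
    have h1 : ContDiffAt ℂ 1 (fun p : (Fin n → ℂ) × ℂ => h p.2 j) (z, l) :=
      (contDiffAt_pi.1 hhl j).comp (z, l) contDiffAt_snd
    have h2 : ContDiffAt ℂ 1 (fun p : (Fin n → ℂ) × ℂ => φ p.2 j) (z, l) :=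
      (contDiffAt_pi.1 hφl j).comp (z, l) contDiffAt_snd
    have h3 : ContDiffAt ℂ 1 (fun p : (Fin n → ℂ) × ℂ => p.1 j) (z, l) :=
      contDiffAt_pi.1 contDiffAt_fst j
    exact h1.mul (h3.sub h2)
  eq z _ l _ := dotn_eq_psi φ h z l
  differentiableOn z _ := (psi_differentiableOn hφ hh z).neg
  re_pos z hz l hl := by
    have hmem : (0 : ℂ) ∈ ball (0 : ℂ) 1 := mem_ball_self one_pos
    have hd : DifferentiableOn ℂ (fun z => psi φ h z 0) D := by
      have h1 : DifferentiableAt ℂ φ 0 := hφ.differentiableAt (isOpen_ball.mem_nhds hmem)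
      have h2 : DifferentiableAt ℂ h 0 := hh.differentiableAt (isOpen_ball.mem_nhds hmem)
      simp only [psi_zero h1 h2, dotn, Pi.sub_apply]
      fun_prop
    have hz0 := re_neg_of_re_nonpos hDopen hDconn hd (hneg 0 hmem) (hφD hmem) h0 z hz
    have := re_neg_of_re_nonpos isOpen_ball (convex_ball (0 : ℂ) 1).isPreconnected
      (psi_differentiableOn hφ hh z) (fun l hl => hneg l hl z hz) hmem hz0.ne l hl
    simpa using this

/-- Sufficient condition for `φ` to be a complex geodesic: if there is a
holomorphic `h` with `Re ψ_{φ(0)}(0) ≠ 0` and `Re ψ_z(λ) ≤ 0` on `𝔻 × D`, then `φ` admits a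
holomorphic left inverse `f : D → 𝔻`. -/
theorem complex_geodesic_sufficient {n : ℕ} (D : Set (Fin n → ℂ))
    (hDopen : IsOpen D) (hDconn : IsConnected D)
    (φ : ℂ → Fin n → ℂ) (hφ : DifferentiableOn ℂ φ (ball (0 : ℂ) 1))
    (hφD : Set.MapsTo φ (ball (0 : ℂ) 1) D)
    (h : ℂ → Fin n → ℂ) (hh : DifferentiableOn ℂ h (ball (0 : ℂ) 1))
    (h0 : (psi φ h (φ 0) 0).re ≠ 0)
    (hneg : ∀ l ∈ ball (0 : ℂ) 1, ∀ z ∈ D, (psi φ h z l).re ≤ 0) :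
    ∃ f : (Fin n → ℂ) → ℂ, DifferentiableOn ℂ f D ∧
      Set.MapsTo f D (ball (0 : ℂ) 1) ∧
      ∀ l ∈ ball (0 : ℂ) 1, f (φ l) = l := by
  have H := isGeneratorFamily_dotn hDopen hDconn.isPreconnected hφ hφD hh h0 hneg
  have hzero : ∀ l, dotn (h l) (φ l - φ l) = 0 := fun l => by simp [dotn]
  have hex : ∀ z, ∃ a : ℂ, z ∈ D → a ∈ ball (0 : ℂ) 1 ∧ dotn (h a) (z - φ a) = 0 := by
    intro z
    by_cases hz : z ∈ D
    · obtain ⟨a, ha, hGa⟩ := H.exists_zero hDopen hDconn.isPreconnected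
        (hφD (mem_ball_self one_pos)) (hzero 0) z hz
      exact ⟨a, fun _ => ⟨ha, hGa⟩⟩
    · exact ⟨0, fun h => absurd h hz⟩
  choose f hf using hex
  refine ⟨f, H.differentiableOn_zero hDopen hf, fun z hz => (hf z hz).1, fun l hl => ?_⟩
  exact H.zero_unique (hφD hl) (hf _ (hφD hl)).1 hl (hf _ (hφD hl)).2 (hzero l)
end
end

section
/- Let D ⊂ R^{2n−1} be a domain (n > 1) such that for every boundary point a ∈ ∂D the vertical line {x ∈ R^{2n−1} : x′ = a′} is not contained in ∂D. Then the semitube domain S_D = Π^{−1}(D) ⊂ C^n is C-convex if and only if it is convex. -/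
open Complex

noncomputable section

variable {m : ℕ}

/-- `ℂⁿ` with `n = m + 1`, modelled as `ℂ^{n-1} × ℂ`. -/
abbrev ECx (m : ℕ) := (Fin m → ℂ) × ℂ

/-- `ℝ^{2n-1}` with `n = m + 1`, modelled as `ℂ^{n-1} × ℝ` via the identification
`(x₁,…,x_{2n-1}) ↔ ((x₁+ix₂,…,x_{2n-3}+ix_{2n-2}), x_{2n-1})`. -/
abbrev BR (m : ℕ) := (Fin m → ℂ) × ℝ

/-- The projection `Π : ℂⁿ → ℝ^{2n-1}`,
`Π(z) = (Re z₁, Im z₁, …, Re z_{n-1}, Im z_{n-1}, Re z_n)`. -/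
def proj (z : ECx m) : BR m := (z.1, z.2.re)

/-- The semitube with base `B ⊂ ℝ^{2n-1}`. -/
def semitube (B : Set (BR m)) : Set (ECx m) := proj ⁻¹' B

/-- The bilinear dot product on `ℂⁿ = ℂ^{n-1} × ℂ`. -/
def dotE (z w : ECx m) : ℂ := ∑ j, z.1 j * w.1 j + z.2 * w.2

/-- A set `G ⊂ ℂⁿ` is linearly convex if its complement is a union of affine complex
hyperplanes, i.e. every point of the complement lies on an affine complex hyperplane
disjoint from `G`. -/
def LinearlyConvex (G : Set (ECx m)) : Prop :=
  ∀ w : ECx m, w ∉ G → ∃ α : ECx m, α ≠ 0 ∧ ∀ z ∈ G, dotE α (z - w) ≠ 0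

/-- A set `G ⊂ ℂⁿ` is `ℂ`-convex if its intersection with every affine complex line is
connected and simply connected (when non-empty), stated via the parametrization
`t ↦ z + t • v` of the line. -/
def CConvex (G : Set (ECx m)) : Prop :=
  ∀ z v : ECx m, v ≠ 0 → ({t : ℂ | z + t • v ∈ G}.Nonempty →
    IsConnected {t : ℂ | z + t • v ∈ G} ∧ SimplyConnectedSpace {t : ℂ | z + t • v ∈ G})

open Set Filter Topology


theorem sub_eq_sub_of_exp_eqOn {X : Type*} [TopologicalSpace X] {S : Set X}
    (hS : IsPreconnected S) {f g : X → ℂ} (hf : ContinuousOn f S) (hg : ContinuousOn g S)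
    {c : ℂ} (h : ∀ x ∈ S, exp (f x) = c * exp (g x)) {x y : X} (hx : x ∈ S) (hy : y ∈ S) :
    f x - g x = f y - g y := by
  refine isCoveringMap_exp.constOn_of_comp (g := fun x => f x - g x) hS (hf.sub hg) ?_ hx hy
  intro a ha b hb
  ext
  simp [exp_sub, h a ha, h b hb, exp_ne_zero]

theorem isSimplyConnected_of_convex {E : Type*} [AddCommGroup E] [Module ℝ E] [TopologicalSpace E]
    [ContinuousAdd E] [ContinuousSMul ℝ E] {s : Set E} (hs : Convex ℝ s) (hne : s.Nonempty) :
    IsSimplyConnected s :=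
  haveI := hs.contractibleSpace hne
  SimplyConnectedSpace.ofContractible s

theorem exists_continuousOn_log_family {W : Set (ℂ × ℂ)} (hW : IsOpen W) {p : ℂ}
    (hsc : ∀ β, IsSimplyConnected {z | (β, z) ∈ W}) (hp : ∀ β, (β, p) ∉ W) :
    ∃ L : ℂ × ℂ → ℂ, ContinuousOn L W ∧ ∀ x ∈ W, exp (L x) = x.2 - p := by
  have hfib : ∀ β, IsOpen {z | (β, z) ∈ W} := fun β => hW.preimage (by fun_prop)
  have hfib' : ∀ z, IsOpen {β | (β, z) ∈ W} := fun z => hW.preimage (by fun_prop)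
  have hne : ∀ β, ∃ z, (β, z) ∈ W := fun β => (hsc β).nonempty
  have hlog : ∀ β, ∃ l : ℂ → ℂ, ContinuousOn l {z | (β, z) ∈ W} ∧
      ∀ z, (β, z) ∈ W → exp (l z) = z - p := by
    intro β
    obtain ⟨l, hl, hl'⟩ := exists_continuousOn_eqOn_exp_comp (hsc β) (hfib β)
      (g := fun z => z - p) (by fun_prop) (by
        rintro ⟨z, hz, hzp⟩
        exact hp β (by rwa [sub_eq_zero.1 hzp] at hz))
    exact ⟨l, hl, fun z hz => hl' hz⟩
  choose l hlc hle using hlog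
  have hloc : ∀ β z, (β, z) ∈ W → ∃ r > 0, ∀ᶠ γ in 𝓝 β, ∀ u ∈ Metric.ball z r,
      (β, u) ∈ W ∧ ∀ v ∈ Metric.ball z r, l γ u - l γ v = l β u - l β v := by
    intro β z hz
    obtain ⟨N, hN, V, hV, hNV⟩ := mem_nhds_prod_iff.1 (hW.mem_nhds hz)
    obtain ⟨r, hr, hrV⟩ := Metric.mem_nhds_iff.1 hV
    refine ⟨r, hr, ?_⟩
    have hβ : ∀ u ∈ Metric.ball z r, (β, u) ∈ W := fun u hu =>
      hNV ⟨mem_of_mem_nhds hN, hrV hu⟩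
    filter_upwards [hN] with γ hγ u hu
    refine ⟨hβ u hu, fun v hv => ?_⟩
    have hγ' : ∀ u ∈ Metric.ball z r, (γ, u) ∈ W := fun u hu => hNV ⟨hγ, hrV hu⟩
    have := sub_eq_sub_of_exp_eqOn (convex_ball z r).isPreconnected ((hlc γ).mono hγ')
      ((hlc β).mono hβ) (c := 1)
      (fun x hx => by rw [hle γ x (hγ' x hx), hle β x (hβ x hx), one_mul]) hu hv
    linear_combination this
  have hdiff : ∀ β z w, (β, z) ∈ W → (β, w) ∈ W →
      ContinuousAt (fun γ => l γ z - l γ w) β := by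
    intro β z w hz hw
    refine (hsc β).isPathConnected.isConnected.isPreconnected.induction₂'
      (fun z w => ContinuousAt (fun γ => l γ z - l γ w) β) ?_ ?_ hz hw
    · intro x hx
      obtain ⟨r, hr, h⟩ := hloc β x hx
      filter_upwards [mem_nhdsWithin_of_mem_nhds (Metric.ball_mem_nhds x hr)] with y hy
      have key : ∀ u ∈ Metric.ball x r, ∀ v ∈ Metric.ball x r,
          ContinuousAt (fun γ => l γ u - l γ v) β := fun u hu v hv =>
        (continuousAt_const (y := l β u - l β v)).congr
          (h.mono fun γ hγ => ((hγ u hu).2 v hv).symm)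
      exact ⟨key _ (Metric.mem_ball_self hr) _ hy, key _ hy _ (Metric.mem_ball_self hr)⟩
    · intro a b c _ _ _ hab hbc
      exact (hab.add hbc).congr (Eventually.of_forall fun γ => sub_add_sub_cancel _ _ _)
  obtain ⟨φ, hφ⟩ := PartitionOfUnity.exists_isSubordinate isClosed_univ
    (fun z : ℂ => {β | (β, z) ∈ W}) hfib' (fun β _ => mem_iUnion.2 (hne β))
  set avg : ℂ → ℂ := fun β => ∑ᶠ z, φ z β • l β z with havg
  have havgc : ∀ β z, (β, z) ∈ W → ContinuousAt (fun γ => avg γ - l γ z) β := by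
    intro β z hz
    obtain ⟨I, n, hn, hnI, hnS⟩ := φ.exists_finset_nhds_support_subset hφ hfib' β
    have hβI : ∀ i ∈ I, (β, i) ∈ W := fun i hi => by
      simpa using mem_iInter₂.1 (hnI (mem_of_mem_nhds hn)) i hi
    have hc : ContinuousAt (fun γ => ∑ i ∈ I, φ i γ • (l γ i - l γ z)) β := by
      refine tendsto_finsetSum _ fun i hi => ?_
      exact ((φ i).continuous.continuousAt).smul (hdiff β i z (hβI i hi) hz)
    refine hc.congr ?_
    filter_upwards [hn] with γ hγ
    have h1 : ∑ i ∈ I, φ i γ = 1 := by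
      refine φ.sum_finsupport' (mem_univ γ) ?_
      intro i hi
      exact hnS γ hγ ((φ.mem_finsupport γ).1 hi)
    have h2 : avg γ = ∑ i ∈ I, φ i γ • l γ i := by
      refine finsum_eq_sum_of_support_subset _ ?_
      refine Subset.trans ?_ (hnS γ hγ)
      intro i hi hi'
      exact hi (by simp only [hi', zero_smul])
    simp only [h2, smul_sub, Finset.sum_sub_distrib, ← Finset.sum_smul, h1, one_smul]
  have hF : Continuous fun β => exp (avg β) := by
    rw [continuous_iff_continuousAt]
    intro β
    obtain ⟨z, hz⟩ := hne β
    refine ((havgc β z hz).cexp.mul (continuousAt_const (y := z - p))).congr ?_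
    filter_upwards [(hfib' z).mem_nhds hz] with γ hγ
    simp only [Pi.mul_apply]
    rw [← hle γ z hγ, ← exp_add, sub_add_cancel]
  obtain ⟨G, hGc, hGe⟩ := exists_continuousOn_eqOn_exp_comp (U := univ) (X := ℂ)
    (isSimplyConnected_of_convex convex_univ univ_nonempty) isOpen_univ hF.continuousOn (by simp [exp_ne_zero])
  refine ⟨fun x => l x.1 x.2 - avg x.1 + G x.1, ?_, ?_⟩
  · rintro ⟨β, z⟩ hx
    apply ContinuousAt.continuousWithinAt
    refine ContinuousAt.add ?_ ?_
    · obtain ⟨r, hr, h⟩ := hloc β z hx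
      have hc : ContinuousAt (fun x : ℂ × ℂ => (l β x.2 - l β z) - (avg x.1 - l x.1 z)) (β, z) := by
        refine ContinuousAt.sub (ContinuousAt.sub ?_ continuousAt_const) ?_
        · exact ContinuousAt.comp (f := Prod.snd) (x := (β, z))
            ((hlc β).continuousAt ((hfib β).mem_nhds hx)) continuousAt_snd
        · exact ContinuousAt.comp (f := Prod.fst) (x := (β, z)) (havgc β z hx) continuousAt_fst
      refine hc.congr ?_
      filter_upwards [prod_mem_nhds h (Metric.ball_mem_nhds z hr)] with y hy
      rw [← (hy.1 y.2 hy.2).2 z (Metric.mem_ball_self hr)]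
      ring
    · exact ContinuousAt.comp (f := Prod.fst) (x := (β, z))
        (hGc.continuousAt univ_mem) continuousAt_fst
  · rintro ⟨β, z⟩ hx
    have h := hGe (mem_univ β)
    simp only [Function.comp] at h
    rw [exp_add, h, ← exp_add, sub_add_cancel, hle β z hx]

/-- The projection to `ℂ` of the slice of `D` by the graph of `z ↦ m + Re (β (z - p))`. -/
def graphSlice (D : Set (ℂ × ℝ)) (p : ℂ) (m : ℝ) (β : ℂ) : Set ℂ :=
  {z | (z, m + (β * (z - p)).re) ∈ D}

/-- `D` is open and all its slices by non-vertical real planes are empty or simply connected. -/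
structure SimplyConnectedSlices (D : Set (ℂ × ℝ)) : Prop where
  isOpen : IsOpen D
  simplyConnected : ∀ p m β, (graphSlice D p m β).Nonempty →
    IsSimplyConnected (graphSlice D p m β)

/-- `D` lies strictly below the plane of slope `β` through `(p, m)`. -/
def LiesBelow (D : Set (ℂ × ℝ)) (p : ℂ) (m : ℝ) (β : ℂ) : Prop :=
  ∀ x ∈ D, x.2 < m + (β * (x.1 - p)).re

/-- The points through which there is a non-vertical plane lying strictly above `D`. -/
def upperPoints (D : Set (ℂ × ℝ)) : Set (ℂ × ℝ) := {q | ∃ β, LiesBelow D q.1 q.2 β}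

/-- No vertical real plane through `p` has all of `D` weakly on one side. -/
def Surrounds (D : Set (ℂ × ℝ)) (p : ℂ) : Prop := ∀ γ ≠ 0, ∃ x ∈ D, (γ * (x.1 - p)).re < 0

/-- The reflection of `D` in the horizontal plane. -/
def vertReflect (D : Set (ℂ × ℝ)) : Set (ℂ × ℝ) := {x | (x.1, -x.2) ∈ D}

theorem mem_vertReflect_of_mem {D : Set (ℂ × ℝ)} {x : ℂ × ℝ} (hx : x ∈ D) :
    (x.1, -x.2) ∈ vertReflect D := by
  simpa [vertReflect] using hx

theorem SimplyConnectedSlices.vertReflect {D : Set (ℂ × ℝ)} (h : SimplyConnectedSlices D) :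
    SimplyConnectedSlices (vertReflect D) := by
  refine ⟨h.isOpen.preimage (by fun_prop), fun p m β => ?_⟩
  have : graphSlice (_root_.vertReflect D) p m β = graphSlice D p (-m) (-β) := by
    ext z
    simp only [graphSlice, _root_.vertReflect, mem_ofPred_eq, neg_mul, neg_re, neg_add]
  rw [this]
  exact h.simplyConnected p (-m) (-β)

theorem Surrounds.vertReflect {D : Set (ℂ × ℝ)} {p : ℂ} (h : Surrounds D p) :
    Surrounds (vertReflect D) p := fun γ hγ =>
  let ⟨x, hx, hx'⟩ := h γ hγ
  ⟨(x.1, -x.2), mem_vertReflect_of_mem hx, hx'⟩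

theorem SimplyConnectedSlices.isPreconnected {D : Set (ℂ × ℝ)} (h : SimplyConnectedSlices D)
    (p : ℂ) (m : ℝ) (β : ℂ) : IsPreconnected (graphSlice D p m β) := by
  rcases (graphSlice D p m β).eq_empty_or_nonempty with h0 | h0
  · rw [h0]
    exact isPreconnected_empty
  · exact (h.simplyConnected p m β h0).isPathConnected.isConnected.isPreconnected

theorem SimplyConnectedSlices.liesBelow_or_of_graphSlice_eq_empty {D : Set (ℂ × ℝ)}
    (h : SimplyConnectedSlices D) {p : ℂ} {m : ℝ} {β : ℂ} (h0 : graphSlice D p m β = ∅) :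
    LiesBelow D p m β ∨ LiesBelow (_root_.vertReflect D) p (-m) (-β) := by
  have hne : ∀ x ∈ D, x.2 ≠ m + (β * (x.1 - p)).re := by
    intro x hx hx'
    have : x.1 ∈ graphSlice D p m β := by
      simp only [graphSlice, mem_ofPred_eq, ← hx']
      exact hx
    rw [h0] at this
    exact this
  by_contra! hcon
  obtain ⟨h1, h2⟩ := hcon
  simp only [LiesBelow, not_forall, not_lt] at h1 h2
  obtain ⟨x, hx, hx'⟩ := h1
  obtain ⟨y, hy, hy'⟩ := h2
  have hx2 : m + (β * (x.1 - p)).re < x.2 := lt_of_le_of_ne hx' (hne x hx).symm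
  have hy2 : -y.2 < m + (β * (y.1 - p)).re := by
    refine lt_of_le_of_ne ?_ (hne _ hy)
    rw [neg_mul, neg_re] at hy'
    linarith
  have hopen : IsOpen {w : ℂ | (w, -y.2) ∈ D ∧ -y.2 < m + (β * (w - p)).re} :=
    (h.isOpen.preimage (by fun_prop : Continuous fun w : ℂ => (w, -y.2))).inter
      (isOpen_lt continuous_const
        (by fun_prop : Continuous fun w : ℂ => m + (β * (w - p)).re))
  obtain ⟨w, ⟨hw, hw2⟩, hwx⟩ :=
    (dense_compl_singleton x.1).inter_open_nonempty _ hopen ⟨y.1, hy, hy2⟩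
  have hwx' : w - x.1 ≠ 0 := sub_ne_zero.2 hwx
  set α : ℂ := ((-y.2 - x.2 : ℝ) : ℂ) / (w - x.1) with hα
  have hαw : x.2 + (α * (w - x.1)).re = -y.2 := by
    rw [hα, div_mul_cancel₀ _ hwx', ofReal_re]
    ring
  have hx1 : x.1 ∈ graphSlice D x.1 x.2 α := by
    simpa [graphSlice] using hx
  have hw1 : w ∈ graphSlice D x.1 x.2 α := by
    simp only [graphSlice, mem_ofPred_eq, hαw]
    exact hw
  obtain ⟨z, hz, hz0⟩ := (h.isPreconnected x.1 x.2 α).intermediate_value hw1 hx1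
    (f := fun z => x.2 + (α * (z - x.1)).re - (m + (β * (z - p)).re)) (by fun_prop)
    (show (0 : ℝ) ∈ Icc _ _ by
      constructor
      · simp only [hαw]
        linarith
      · simp only [sub_self, mul_zero, zero_re]
        linarith)
  exact hne _ hz (sub_eq_zero.1 hz0)

theorem SimplyConnectedSlices.exists_log {D : Set (ℂ × ℝ)} (h : SimplyConnectedSlices D)
    {p : ℂ} {m : ℝ} (hpm : (p, m) ∉ D) (hne : ∀ β, (graphSlice D p m β).Nonempty) :
    ∃ A : ℂ × ℝ → ℂ, ContinuousOn A {x ∈ D | x.1 ≠ p} ∧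
      ∀ x ∈ D, x.1 ≠ p → exp (A x) = x.1 - p := by
  obtain ⟨L, hL, hLe⟩ := exists_continuousOn_log_family
    (W := {x : ℂ × ℂ | (x.2, m + (x.1 * (x.2 - p)).re) ∈ D}) (p := p)
    (h.isOpen.preimage (by fun_prop)) (fun β => h.simplyConnected p m β (hne β))
    (fun β => by simpa using hpm)
  have hmem : ∀ x ∈ D, x.1 ≠ p → (((x.2 - m : ℝ) : ℂ) / (x.1 - p), x.1) ∈
      {x : ℂ × ℂ | (x.2, m + (x.1 * (x.2 - p)).re) ∈ D} := by
    intro x hx hxp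
    simp only [mem_ofPred_eq, div_mul_cancel₀ _ (sub_ne_zero.2 hxp), ofReal_re,
      add_sub_cancel]
    exact hx
  refine ⟨fun x => L (((x.2 - m : ℝ) : ℂ) / (x.1 - p), x.1), ?_, fun x hx hxp =>
    hLe _ (hmem x hx hxp)⟩
  refine hL.comp (f := fun x : ℂ × ℝ => (((x.2 - m : ℝ) : ℂ) / (x.1 - p), x.1)) ?_
    fun x hx => hmem x hx.1 hx.2
  refine ContinuousOn.prodMk (ContinuousOn.div (by fun_prop) (by fun_prop) ?_) (by fun_prop)
  exact fun x hx => sub_ne_zero.2 hx.2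

theorem SimplyConnectedSlices.exists_graphSlice_eq_empty {D : Set (ℂ × ℝ)}
    (h : SimplyConnectedSlices D) {p : ℂ} {m s : ℝ} (hs : (p, s) ∈ D) (hm : (p, m) ∉ D) :
    ∃ β, graphSlice D p m β = ∅ := by
  by_contra! hne
  obtain ⟨A, hA, hAe⟩ := h.exists_log hm hne
  have hnhds : {z : ℂ | (z, s) ∈ D} ∈ 𝓝 p :=
    (h.isOpen.preimage (by fun_prop : Continuous fun z : ℂ => (z, s))).mem_nhds hs
  obtain ⟨r, hr, hrD⟩ := Metric.nhds_basis_closedBall.mem_iff.1 hnhds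
  have hne : ∀ θ : ℝ, circleMap p r θ ≠ p := fun θ => circleMap_ne_center hr.ne'
  have hD : ∀ θ : ℝ, (circleMap p r θ, s) ∈ D := fun θ =>
    hrD (circleMap_mem_closedBall p hr.le θ)
  have key := sub_eq_sub_of_exp_eqOn (isPreconnected_univ (α := ℝ))
    (f := fun θ => A (circleMap p r θ, s)) (g := fun θ => θ * I) (c := r)
    (hA.comp (by fun_prop) fun θ _ => ⟨hD θ, hne θ⟩) (by fun_prop)
    (fun θ _ => by rw [hAe _ (hD θ) (hne θ), circleMap, add_sub_cancel_left])
    (mem_univ 0) (mem_univ (2 * Real.pi))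
  have hper : circleMap p r (2 * Real.pi) = circleMap p r 0 := by simp [circleMap]
  rw [hper] at key
  have h0 : (2 * Real.pi : ℂ) * I = 0 := by
    push_cast at key
    linear_combination key
  simp [Real.pi_ne_zero] at h0

theorem Surrounds.exists_bound {D : Set (ℂ × ℝ)} {p : ℂ} (h : Surrounds D p) :
    ∃ δ > 0, ∃ C : ℝ, ∀ p' m β, dist p' p < δ → LiesBelow D p' m β → ‖β‖ * δ ≤ m + C := by
  have hcomp : ∃ δ > 0, ∃ C : ℝ, ∀ γ ∈ Metric.sphere (0 : ℂ) 1,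
      ∃ x ∈ D, (γ * (x.1 - p)).re < -δ ∧ -C ≤ x.2 := by
    refine (isCompact_sphere (0 : ℂ) 1).induction_on
      (p := fun S => ∃ δ > 0, ∃ C : ℝ, ∀ γ ∈ S, ∃ x ∈ D, (γ * (x.1 - p)).re < -δ ∧ -C ≤ x.2)
      ⟨1, one_pos, 0, by simp⟩ ?_ ?_ ?_
    · rintro S T hST ⟨δ, hδ, C, hC⟩
      exact ⟨δ, hδ, C, fun γ hγ => hC γ (hST hγ)⟩
    · rintro S T ⟨δ, hδ, C, hC⟩ ⟨δ', hδ', C', hC'⟩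
      refine ⟨min δ δ', lt_min hδ hδ', max C C', ?_⟩
      rintro γ (hγ | hγ)
      · obtain ⟨x, hx, h1, h2⟩ := hC γ hγ
        exact ⟨x, hx, by linarith [min_le_left δ δ'], by linarith [le_max_left C C']⟩
      · obtain ⟨x, hx, h1, h2⟩ := hC' γ hγ
        exact ⟨x, hx, by linarith [min_le_right δ δ'], by linarith [le_max_right C C']⟩
    · intro γ hγ
      have hγ0 : γ ≠ 0 := by
        rintro rfl
        simp at hγ
      obtain ⟨x, hx, hx'⟩ := h γ hγ0
      refine ⟨{γ' | (γ' * (x.1 - p)).re < (γ * (x.1 - p)).re / 2},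
        mem_nhdsWithin_of_mem_nhds ?_, -((γ * (x.1 - p)).re / 2), by linarith, -x.2, ?_⟩
      · exact (isOpen_lt (by fun_prop) (by fun_prop)).mem_nhds (by simp only [mem_ofPred_eq]; linarith)
      · intro γ' hγ'
        exact ⟨x, hx, by simpa using hγ', by simp⟩
  obtain ⟨δ, hδ, C, hC⟩ := hcomp
  refine ⟨δ / 2, by linarith, C, fun p' m β hp' hb => ?_⟩
  obtain ⟨γ, hγ, hβ⟩ : ∃ γ ∈ Metric.sphere (0 : ℂ) 1, β = ‖β‖ * γ := by
    by_cases h0 : β = 0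
    · exact ⟨1, by simp, by simp [h0]⟩
    · have : (‖β‖ : ℂ) ≠ 0 := by simpa using h0
      refine ⟨β / ‖β‖, by simp [h0], by field_simp⟩
  obtain ⟨x, hx, h1, h2⟩ := hC γ hγ
  have h3 := hb x hx
  have h4 : (β * (x.1 - p')).re = ‖β‖ * (γ * (x.1 - p')).re := by
    conv_lhs => rw [hβ]
    rw [mul_assoc, re_ofReal_mul]
  have h5 : (γ * (x.1 - p')).re = (γ * (x.1 - p)).re - (γ * (p' - p)).re := by
    rw [← sub_re]
    ring_nf
  have h6 : |(γ * (p' - p)).re| ≤ dist p' p := by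
    refine (abs_re_le_norm _).trans ?_
    rw [norm_mul, mem_sphere_zero_iff_norm.1 hγ, one_mul, dist_eq]
  have h7 := (abs_le.1 h6).1
  have h8 : (γ * (x.1 - p')).re ≤ -(δ / 2) := by linarith
  have h9 := mul_le_mul_of_nonneg_left h8 (norm_nonneg β)
  linarith

theorem Surrounds.mem_upperPoints_of_mem_closure {D : Set (ℂ × ℝ)} (hD : IsOpen D) {p : ℂ}
    (h : Surrounds D p) {m : ℝ} (hm : (p, m) ∈ closure (upperPoints D)) :
    (p, m) ∈ upperPoints D := by
  obtain ⟨δ, hδ, C, hC⟩ := h.exists_bound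
  obtain ⟨q, hq, hqlim⟩ := mem_closure_iff_seq_limit.1 hm
  choose β hβ using hq
  have hq1 : Tendsto (fun k => (q k).1) atTop (𝓝 p) := (continuous_fst.tendsto (p, m)).comp hqlim
  have hq2 : Tendsto (fun k => (q k).2) atTop (𝓝 m) := (continuous_snd.tendsto (p, m)).comp hqlim
  have hbd : ∀ᶠ k in atTop, β k ∈ Metric.closedBall (0 : ℂ) ((m + 1 + C) / δ) := by
    filter_upwards [hq1.eventually (Metric.ball_mem_nhds p hδ),
      hq2.eventually (gt_mem_nhds (lt_add_one m))] with k hk1 hk2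
    rw [mem_closedBall_zero_iff, le_div_iff₀ hδ]
    linarith [hC _ _ _ hk1 (hβ k)]
  obtain ⟨b, -, φ, hφ, hlim⟩ :=
    (isCompact_closedBall (0 : ℂ) ((m + 1 + C) / δ)).tendsto_subseq' hbd.frequently
  have hle : ∀ x ∈ D, x.2 ≤ m + (b * (x.1 - p)).re := by
    intro x hx
    have hl : Tendsto (fun k => (q (φ k)).2 + (β (φ k) * (x.1 - (q (φ k)).1)).re) atTop
        (𝓝 (m + (b * (x.1 - p)).re)) :=
      (hq2.comp hφ.tendsto_atTop).add ((continuous_re.tendsto _).comp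
        (hlim.mul (tendsto_const_nhds.sub (hq1.comp hφ.tendsto_atTop))))
    exact ge_of_tendsto' hl fun k => (hβ (φ k) x hx).le
  refine ⟨b, fun x hx => ?_⟩
  have hnhds : {s : ℝ | (x.1, s) ∈ D} ∈ 𝓝 x.2 :=
    (hD.preimage (by fun_prop : Continuous fun s : ℝ => (x.1, s))).mem_nhds hx
  obtain ⟨s, hs, hsD⟩ := (mem_nhdsGT_iff_exists_Ioo_subset.1
    (mem_nhdsWithin_of_mem_nhds hnhds))
  have hs' : x.2 < s := hs
  have := hle (x.1, (x.2 + s) / 2) (hsD ⟨by linarith, by linarith⟩)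
  simp only at this ⊢
  linarith

theorem SimplyConnectedSlices.notMem_upperPoints {D : Set (ℂ × ℝ)} (h : SimplyConnectedSlices D)
    {p : ℂ} (hp : ∀ x ∈ D, x.1 ≠ p) (hs : Surrounds D p) (m₀ : ℝ) :
    (p, m₀) ∉ upperPoints D := by
  intro hm₀
  obtain ⟨δ, hδ, C, hC⟩ := hs.exists_bound
  have hbound : ∀ m β, LiesBelow D p m β → ‖β‖ * δ ≤ m + C := fun m β =>
    hC p m β (by simpa using hδ)
  have hclosed : ∀ {D : Set (ℂ × ℝ)} (_ : IsOpen D) (_ : Surrounds D p),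
      IsClosed {m : ℝ | (p, m) ∈ upperPoints D} := fun hD hs =>
    isClosed_of_closure_subset fun m hm => hs.mem_upperPoints_of_mem_closure hD
      (map_mem_closure (f := fun m : ℝ => (p, m)) (by fun_prop) hm fun _ hx => hx)
  have hS := hclosed h.isOpen hs
  have hT : IsClosed {m : ℝ | (p, -m) ∈ upperPoints (_root_.vertReflect D)} :=
    (hclosed h.vertReflect.isOpen hs.vertReflect).preimage continuous_neg
  set S := {m : ℝ | (p, m) ∈ upperPoints D}
  set T := {m : ℝ | (p, -m) ∈ upperPoints (_root_.vertReflect D)}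
  have hST : ∀ m ∈ S, m ∉ T := by
    rintro m ⟨β, hβ⟩ ⟨γ, hγ⟩
    have hsum : ∀ x ∈ D, 0 < ((β + γ) * (x.1 - p)).re := by
      intro x hx
      have h1 := hβ x hx
      have h2 := hγ _ (mem_vertReflect_of_mem hx)
      rw [add_mul, add_re]
      simp only at h1 h2
      linarith
    by_cases h0 : β + γ = 0
    · obtain ⟨x, hx, -⟩ := hs 1 one_ne_zero
      simpa [h0] using hsum x hx
    · obtain ⟨x, hx, hx'⟩ := hs _ h0
      linarith [hsum x hx]
  have hSb : BddBelow S := ⟨-C, by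
    rintro m ⟨β, hβ⟩
    have := hbound m β hβ
    have := mul_nonneg (norm_nonneg β) hδ.le
    linarith⟩
  have hm₁ : sInf S ∈ S := hS.csInf_mem ⟨m₀, hm₀⟩ hSb
  set m₁ := sInf S with hm₁def
  obtain ⟨m, hmT, hm⟩ : ∃ m, m ∉ T ∧ m < m₁ := by
    have hev : ∀ᶠ m in 𝓝[<] m₁, m ∉ T :=
      mem_nhdsWithin_of_mem_nhds (hT.isOpen_compl.mem_nhds (hST m₁ hm₁))
    exact (hev.and self_mem_nhdsWithin).exists
  have hmS : m ∉ S := notMem_of_lt_csInf hm hSb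
  have hpD : ∀ s, (p, s) ∉ D := fun s hsD => hp _ hsD rfl
  have hne : ∀ m β, ¬ LiesBelow D p m β → m ∉ T → (graphSlice D p m β).Nonempty := by
    intro m β h1 h2
    rw [nonempty_iff_ne_empty]
    intro h0
    rcases h.liesBelow_or_of_graphSlice_eq_empty h0 with h3 | h3
    · exact h1 h3
    · exact h2 ⟨_, h3⟩
  obtain ⟨A, hA, hAe⟩ := h.exists_log (hpD m) fun β => hne m β (fun hb => hmS ⟨β, hb⟩) hmT
  obtain ⟨b, hb⟩ := hm₁
  set R : ℝ := ‖b‖ + (|m₁ + C| + 1) / δ with hR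
  have hRpos : 0 < R := by positivity
  have hUne : ∀ θ : ℝ, (graphSlice D p m₁ (circleMap b R θ)).Nonempty := by
    intro θ
    refine hne m₁ _ (fun hb' => ?_) (hST m₁ ⟨b, hb⟩)
    have h1 := hbound _ _ hb'
    have h2 : R - ‖b‖ ≤ ‖circleMap b R θ‖ := by
      have := norm_sub_le (circleMap b R θ) b
      rw [circleMap_sub_center, norm_circleMap_zero, abs_of_pos hRpos] at this
      linarith
    have h3 : (|m₁ + C| + 1) / δ ≤ ‖circleMap b R θ‖ := by linarith
    rw [div_le_iff₀ hδ] at h3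
    linarith [le_abs_self (m₁ + C)]
  have hneg : ∀ θ : ℝ, ∀ z ∈ graphSlice D p m₁ (circleMap b R θ),
      0 < (-(exp (θ * I) * (z - p))).re := by
    intro θ z hz
    have h1 := hb _ hz
    simp only [circleMap, add_mul, add_re] at h1
    have h2 : ((R : ℂ) * exp (θ * I) * (z - p)).re = R * (exp (θ * I) * (z - p)).re := by
      rw [mul_assoc, re_ofReal_mul]
    rw [h2] at h1
    have h3 : R * (exp (θ * I) * (z - p)).re < 0 := by linarith
    rw [neg_re]
    linarith [neg_of_mul_neg_right h3 hRpos.le]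
  set c : ℝ → ℂ → ℂ := fun θ z =>
    A (z, m₁ + (circleMap b R θ * (z - p)).re) + (θ * I - log (-(exp (θ * I) * (z - p)))) with hc
  have hlogz : ∀ θ : ℝ, ∀ z ∈ graphSlice D p m₁ (circleMap b R θ),
      exp (log (-(exp (θ * I) * (z - p)))) = -(exp (θ * I) * (z - p)) := by
    intro θ z hz
    refine exp_log fun h0 => ?_
    have := hneg θ z hz
    rw [h0] at this
    simp at this
  have hcz : ∀ θ, ∀ z ∈ graphSlice D p m₁ (circleMap b R θ),
      ∀ w ∈ graphSlice D p m₁ (circleMap b R θ), c θ z = c θ w := by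
    intro θ z hz w hw
    have key := sub_eq_sub_of_exp_eqOn (h.isPreconnected p m₁ (circleMap b R θ))
      (f := fun z => A (z, m₁ + (circleMap b R θ * (z - p)).re))
      (g := fun z => log (-(exp (θ * I) * (z - p)))) (c := -exp (-(θ * I)))
      (hA.comp (by fun_prop) fun z hz => ⟨hz, hp _ hz⟩)
      (ContinuousOn.clog (by fun_prop) fun z hz => Or.inl (hneg θ z hz))
      (fun z hz => by
        rw [hAe _ hz (hp _ hz), hlogz θ z hz, neg_mul_neg, ← mul_assoc, ← exp_add,
          neg_add_cancel, exp_zero, one_mul]) hz hw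
    simp only [hc]
    linear_combination key
  have hcθ : ∀ θ, ∀ z ∈ graphSlice D p m₁ (circleMap b R θ), ∀ᶠ η in 𝓝 θ,
      z ∈ graphSlice D p m₁ (circleMap b R η) ∧ c η z = c θ z := by
    intro θ z hz
    have hopen : IsOpen {η : ℝ | (z, m₁ + (circleMap b R η * (z - p)).re) ∈ D} :=
      h.isOpen.preimage (by fun_prop)
    obtain ⟨ε, hε, hεD⟩ := Metric.mem_nhds_iff.1 (hopen.mem_nhds hz)
    filter_upwards [Metric.ball_mem_nhds θ hε] with η hη
    refine ⟨hεD hη, ?_⟩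
    have key := sub_eq_sub_of_exp_eqOn (convex_ball θ ε).isPreconnected
      (f := fun η : ℝ => A (z, m₁ + (circleMap b R η * (z - p)).re))
      (g := fun η : ℝ => log (-(exp (η * I) * (z - p))) - η * I) (c := -1)
      (hA.comp (by fun_prop) fun η hη => ⟨hεD hη, hp _ (hεD hη)⟩)
      (ContinuousOn.sub
        (ContinuousOn.clog (by fun_prop) fun η hη => Or.inl (hneg η z (hεD hη))) (by fun_prop))
      (fun η hη => by
        rw [hAe _ (hεD hη) (hp _ (hεD hη)), exp_sub, hlogz η z (hεD hη)]
        field_simp [exp_ne_zero]) hη (Metric.mem_ball_self hε)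
    simp only [hc]
    linear_combination key
  choose ζ hζ using hUne
  have hk : IsLocallyConstant fun θ => c θ (ζ θ) := by
    rw [IsLocallyConstant.iff_eventually_eq]
    intro θ
    filter_upwards [hcθ θ (ζ θ) (hζ θ)] with η hη
    rw [hcz η _ (hζ η) _ hη.1, hη.2]
  have hper : circleMap b R (2 * Real.pi) = circleMap b R 0 := by simp [circleMap]
  have hk0 := hk.apply_eq_of_isPreconnected isPreconnected_univ (mem_univ (2 * Real.pi))
    (mem_univ 0)
  have hζ' : ζ 0 ∈ graphSlice D p m₁ (circleMap b R (2 * Real.pi)) := hper ▸ hζ 0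
  beta_reduce at hk0
  rw [hcz _ _ (hζ _) _ hζ'] at hk0
  simp [hc, hper, Real.pi_ne_zero] at hk0

theorem SimplyConnectedSlices.convex {D : Set (ℂ × ℝ)} (h : SimplyConnectedSlices D)
    (hvert : ∀ z, (∀ s, (z, s) ∉ D) → ∃ s, (z, s) ∉ closure D) : Convex ℝ D := by
  have hΩ : IsOpen (Prod.fst '' D) := isOpenMap_fst _ h.isOpen
  have hproj : ∀ P ∈ D, ∀ Q ∈ D, ∀ t ∈ Icc (0 : ℝ) 1,
      P.1 + t * (Q.1 - P.1) ∈ Prod.fst '' D := by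
    intro P hP Q hQ
    by_contra! hcon
    set f : ℝ → ℂ := fun t => P.1 + t * (Q.1 - P.1) with hf
    have hfc : Continuous f := by fun_prop
    set T := Icc (0 : ℝ) 1 ∩ f ⁻¹' (Prod.fst '' D)ᶜ with hT
    have hTc : IsClosed T := isClosed_Icc.inter (hΩ.isClosed_compl.preimage hfc)
    have hTb : BddBelow T := ⟨0, fun t ht => ht.1.1⟩
    have hTne : T.Nonempty := by
      obtain ⟨t, ht, ht'⟩ := hcon
      exact ⟨t, ht, ht'⟩
    have ht₀ := hTc.csInf_mem hTne hTb
    set t₀ := sInf T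
    have hf0 : f 0 = P.1 := by simp [hf]
    have hf1 : f 1 = Q.1 := by simp [hf]
    have ht₀0 : 0 < t₀ := by
      refine lt_of_le_of_ne ht₀.1.1 fun h0 => ht₀.2 ?_
      rw [← h0, hf0]
      exact ⟨P, hP, rfl⟩
    have ht₀1 : t₀ < 1 := by
      refine lt_of_le_of_ne ht₀.1.2 fun h0 => ht₀.2 ?_
      rw [h0, hf1]
      exact ⟨Q, hQ, rfl⟩
    have hp : ∀ x ∈ D, x.1 ≠ f t₀ := fun x hx hx' => ht₀.2 ⟨x, hx, hx'⟩
    have hsur : Surrounds D (f t₀) := by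
      intro γ hγ
      by_contra! hge
      have hpos : ∀ x ∈ D, 0 < (γ * (x.1 - f t₀)).re := by
        intro x hx
        have hcont : Continuous fun ε : ℝ => x.1 - ε * (starRingEnd ℂ) γ := by fun_prop
        have hev : ∀ᶠ ε : ℝ in 𝓝[>] 0, x.1 - ε * (starRingEnd ℂ) γ ∈ Prod.fst '' D :=
          mem_nhdsWithin_of_mem_nhds ((hΩ.preimage hcont).mem_nhds (by simpa using ⟨x.2, hx⟩))
        obtain ⟨ε, ⟨y, hy, hyx⟩, hε⟩ := (hev.and self_mem_nhdsWithin).exists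
        have hε' : 0 < ε := hε
        have h1 := hge y hy
        rw [hyx] at h1
        have h2 : γ * (x.1 - ε * (starRingEnd ℂ) γ - f t₀) =
            γ * (x.1 - f t₀) - (ε * normSq γ : ℝ) := by
          push_cast
          rw [normSq_eq_conj_mul_self]
          ring
        rw [h2, sub_re, ofReal_re] at h1
        have := mul_pos hε' (normSq_pos.2 hγ)
        linarith
      have h1 := hpos P hP
      have h2 := hpos Q hQ
      have h3 : P.1 - f t₀ = ((-t₀ : ℝ) : ℂ) * (Q.1 - P.1) := by
        simp only [hf]
        push_cast
        ring
      have h4 : Q.1 - f t₀ = ((1 - t₀ : ℝ) : ℂ) * (Q.1 - P.1) := by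
        simp only [hf]
        push_cast
        ring
      rw [h3, mul_left_comm, re_ofReal_mul] at h1
      rw [h4, mul_left_comm, re_ofReal_mul] at h2
      nlinarith
    obtain ⟨s, hs⟩ := hvert (f t₀) fun s hs => hp _ hs rfl
    have hmem : (f t₀, s) ∈ closure (upperPoints D ∪
        (fun q : ℂ × ℝ => (q.1, -q.2)) ⁻¹' upperPoints (_root_.vertReflect D)) := by
      have hcont : Continuous fun t => (f t, s) := by fun_prop
      refine mem_closure_of_tendsto (b := 𝓝[<] t₀)
        (hcont.continuousAt.tendsto.mono_left nhdsWithin_le_nhds) ?_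
      have hev : ∀ᶠ t in 𝓝[<] t₀, (f t, s) ∈ (closure D)ᶜ :=
        mem_nhdsWithin_of_mem_nhds
          ((isClosed_closure.isOpen_compl.preimage hcont).mem_nhds hs)
      filter_upwards [hev, Ioo_mem_nhdsLT ht₀0] with t ht ht'
      have htT : t ∉ T := notMem_of_lt_csInf ht'.2 hTb
      have hft : f t ∈ Prod.fst '' D := by
        by_contra hft
        exact htT ⟨⟨ht'.1.le, by linarith [ht'.2]⟩, hft⟩
      obtain ⟨x, hx, hxf⟩ := hft
      obtain ⟨β, hβ⟩ := h.exists_graphSlice_eq_empty (p := f t) (s := x.2) (m := s)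
        (by rw [← hxf]; exact hx) fun hD => ht (subset_closure hD)
      exact (h.liesBelow_or_of_graphSlice_eq_empty hβ).imp (fun hb => ⟨_, hb⟩) fun hb => ⟨_, hb⟩
    rw [closure_union] at hmem
    rcases hmem with hmem | hmem
    · exact h.notMem_upperPoints hp hsur s (hsur.mem_upperPoints_of_mem_closure h.isOpen hmem)
    · have hmem' : (f t₀, -s) ∈ closure (upperPoints (_root_.vertReflect D)) :=
        map_mem_closure (f := fun q : ℂ × ℝ => (q.1, -q.2)) (by fun_prop) hmem fun _ hx => hx
      exact h.vertReflect.notMem_upperPoints (fun x hx => hp (x.1, -x.2) hx) hsur.vertReflect (-s)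
        (hsur.vertReflect.mem_upperPoints_of_mem_closure h.vertReflect.isOpen hmem')
  intro P hP Q hQ a b ha hb hab
  by_contra hM
  have ha' : a = 1 - b := by linarith
  have hM1 : P.1 + b * (Q.1 - P.1) = (a • P + b • Q).1 := by
    simp only [Prod.fst_add, Prod.smul_fst, real_smul, ha']
    push_cast
    ring
  obtain ⟨x, hx, hxM⟩ := hproj P hP Q hQ b ⟨hb, by linarith⟩
  rw [hM1] at hxM
  have hside : ∀ {D : Set (ℂ × ℝ)} {P Q : ℂ × ℝ} {β : ℂ}, P ∈ D → Q ∈ D →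
      ¬ LiesBelow D (a • P + b • Q).1 (a • P + b • Q).2 β := by
    intro D P Q β hP hQ hb'
    have h1 := hb' P hP
    have h2 := hb' Q hQ
    simp only [Prod.fst_add, Prod.snd_add, Prod.smul_fst, Prod.smul_snd, real_smul,
      smul_eq_mul] at h1 h2
    have h3 : P.1 - (a * P.1 + b * Q.1) = ((-b : ℝ) : ℂ) * (Q.1 - P.1) := by
      rw [ha']
      push_cast
      ring
    have h4 : Q.1 - (a * P.1 + b * Q.1) = (a : ℂ) * (Q.1 - P.1) := by
      rw [ha']
      push_cast
      ring
    rw [h3, mul_left_comm, re_ofReal_mul] at h1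
    rw [h4, mul_left_comm, re_ofReal_mul] at h2
    rcases ha.eq_or_lt with h0 | h0
    · have hb1 : b = 1 := by linarith
      rw [← h0, hb1] at h2
      linarith
    · have h5 := mul_lt_mul_of_pos_left h1 h0
      have h6 := mul_le_mul_of_nonneg_left h2.le hb
      rw [ha'] at h5 h6
      linarith
  obtain ⟨β, hβ⟩ := h.exists_graphSlice_eq_empty (p := (a • P + b • Q).1) (s := x.2)
    (m := (a • P + b • Q).2) (by rw [← hxM]; exact hx) hM
  rcases h.liesBelow_or_of_graphSlice_eq_empty hβ with hb' | hb'
  · exact hside hP hQ hb'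
  · refine hside (P := (P.1, -P.2)) (Q := (Q.1, -Q.2)) (mem_vertReflect_of_mem hP)
      (mem_vertReflect_of_mem hQ) (β := -β) ?_
    convert hb' using 1
    · simp
    · simp only [Prod.snd_add, Prod.smul_snd, smul_eq_mul]
      ring

theorem cConvex_of_convex {m : ℕ} {G : Set (ECx m)} (hG : Convex ℝ G) : CConvex G := by
  intro z v _ hne
  have hconv : Convex ℝ {t : ℂ | z + t • v ∈ G} := by
    intro s hs t ht a b ha hb hab
    have : z + (a • s + b • t) • v = a • (z + s • v) + b • (z + t • v) := by
      rw [smul_add, smul_add, add_add_add_comm, ← add_smul, hab, one_smul, add_smul, smul_assoc,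
        smul_assoc]
    simp only [mem_ofPred_eq, this]
    exact hG hs ht ha hb hab
  exact ⟨⟨hne, hconv.isPreconnected⟩,
    (isSimplyConnected_of_convex hconv hne).simplyConnectedSpace⟩

theorem CConvex.convex_base {m : ℕ} (hm : 1 ≤ m) {D : Set (BR m)} (hD : IsOpen D)
    (hvert : ∀ a ∈ frontier D, ¬ ({x : BR m | x.1 = a.1} ⊆ frontier D))
    (hG : CConvex (semitube D)) : Convex ℝ D := by
  intro P hP Q hQ a b ha hb hab
  obtain ⟨v, hv, τ, hτ⟩ : ∃ v : Fin m → ℂ, v ≠ 0 ∧ ∃ τ : ℂ, Q.1 = P.1 + τ • v := by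
    by_cases h : Q.1 = P.1
    · exact ⟨fun _ => 1, fun h0 => one_ne_zero (congrFun h0 ⟨0, hm⟩), 0, by simp [h]⟩
    · exact ⟨Q.1 - P.1, sub_ne_zero.2 h, 1, by simp⟩
  set g : ℂ × ℝ → BR m := fun x => (P.1 + x.1 • v, x.2) with hg
  have hgc : Continuous g := by fun_prop
  have hslices : SimplyConnectedSlices (g ⁻¹' D) := by
    refine ⟨hD.preimage hgc, fun p μ β hne => ?_⟩
    have heq : graphSlice (g ⁻¹' D) p μ β =
        {t : ℂ | ((P.1, (μ : ℂ) - β * p) : ECx m) + t • ((v, β) : ECx m) ∈ semitube D} := by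
      ext t
      simp only [graphSlice, hg, semitube, proj, mem_ofPred_eq, mem_preimage, Prod.fst_add,
        Prod.smul_fst, Prod.snd_add, Prod.smul_snd, smul_eq_mul, add_re, sub_re, ofReal_re, mul_sub,
        mul_comm t β]
      rw [sub_add_eq_add_sub, add_sub_assoc]
    rw [heq] at hne ⊢
    exact (hG _ _ (fun h => hv (Prod.ext_iff.1 h).1) hne).2
  have hconv := hslices.convex (by
    intro z hz
    by_contra! hcl
    have hfr : ∀ s, (P.1 + z • v, s) ∈ frontier D := by
      intro s
      rw [hD.frontier_eq]
      have hmem : g (z, s) ∈ closure D := map_mem_closure hgc (hcl s) fun _ hx => hx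
      exact ⟨hmem, hz s⟩
    refine hvert _ (hfr 0) ?_
    rintro ⟨x, s⟩ hx
    obtain rfl : x = P.1 + z • v := hx
    exact hfr s)
  have h0 : ((0 : ℂ), P.2) ∈ g ⁻¹' D := by simpa [hg] using hP
  have h1 : (τ, Q.2) ∈ g ⁻¹' D := by
    simp only [hg, mem_preimage, ← hτ]
    exact hQ
  have h2 : g (a • ((0 : ℂ), P.2) + b • (τ, Q.2)) ∈ D := hconv h0 h1 ha hb hab
  convert h2 using 1
  refine Prod.ext ?_ rfl
  simp only [hg, Prod.fst_add, Prod.smul_fst, hτ, smul_zero, zero_add, smul_add, smul_assoc]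
  rw [← add_assoc, ← add_smul, hab, one_smul]

theorem Convex.semitube {m : ℕ} {D : Set (BR m)} (hD : Convex ℝ D) :
    Convex ℝ (semitube D) := by
  intro z hz w hw a b ha hb hab
  have h : a • proj z + b • proj w ∈ D := hD hz hw ha hb hab
  have h' : proj (a • z + b • w) = a • proj z + b • proj w := by
    refine Prod.ext rfl ?_
    simp [proj]
  exact mem_preimage.2 (h' ▸ h)

/-- Let `D ⊂ ℝ^{2n-1}` be a domain (`n > 1`) such that no vertical line
`{x : x' = a'}` through a boundary point `a ∈ ∂D` is contained in `∂D`. Then the semitube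
`𝒮_D` is `ℂ`-convex iff it is convex. -/
theorem cConvex_semitube_iff_convex {m : ℕ} (hm : 1 ≤ m) (D : Set (BR m))
    (hDopen : IsOpen D) (hDconn : IsConnected D)
    (hvert : ∀ a ∈ frontier D, ¬ ({x : BR m | x.1 = a.1} ⊆ frontier D)) :
    CConvex (semitube D) ↔ Convex ℝ (semitube D) := by
  exact ⟨fun h => (h.convex_base hm hDopen hvert).semitube, cConvex_of_convex⟩
end
end
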